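/- arXiv:2207.03957 — 4 statements merged into one kernel-verified Lean document; each statement's English description precedes it below -/
import Mathlib

section
/- (Convergence of the Proximal-Point Method, Theorem 9, iteration complexity.) Under the same setup as the PPM contraction result (G μ_x-strongly convex, F* μ_y-strongly convex, (x*, y*) satisfying −K^⊤y* ∈ ∂G(x*) and K x* ∈ ∂F*(y*), and iterates x^{k+1} = x^k − η_x (g^k + K^⊤ y^{k+1}), y^{k+1} = y^k − η_y (h^k − K x^{k+1}) with g^k ∈ ∂G(x^{k+1}), h^k ∈ ∂F*(y^{k+1})), define Δ^k := (1/η_x)‖x^k − x*‖² + (1/η_y)‖y^k − y*‖². Then for every ε > 0 and every natural number k with k ≥ (1 + 1/min{2 μ_x η_x, 2 μ_y η_y}) · log(1/ε), one has Δ^k ≤ ε Δ^0. -/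
open RealInnerProductSpace

/-- `g` is a subgradient of `f` at `u`: `f v ≥ f u + ⟨g, v - u⟩` for all `v`. -/
def IsSubgradientAt {E : Type*} [NormedAddCommGroup E] [InnerProductSpace ℝ E]
    (f : E → ℝ) (g u : E) : Prop :=
  ∀ v, f u + ⟪g, v - u⟫ ≤ f v

/-- `f` is `μ`-strongly convex in the subgradient sense. -/
def StronglyConvexSubgrad {E : Type*} [NormedAddCommGroup E] [InnerProductSpace ℝ E]
    (f : E → ℝ) (μ : ℝ) : Prop :=
  ∀ u v g, IsSubgradientAt f g u → f u + ⟪g, v - u⟫ + μ / 2 * ‖v - u‖ ^ 2 ≤ f v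

/-- Strong monotonicity of subgradients. -/
lemma ppm_mono {E : Type*} [NormedAddCommGroup E] [InnerProductSpace ℝ E]
    {f : E → ℝ} {μ : ℝ} (hf : StronglyConvexSubgrad f μ) {u v g w : E}
    (h1 : IsSubgradientAt f g u) (h2 : IsSubgradientAt f w v) :
    μ * ‖u - v‖ ^ 2 ≤ ⟪g, u - v⟫ - ⟪w, u - v⟫ := by
  have a := hf u v g h1
  have b := hf v u w h2
  have e : v - u = -(u - v) := by abel
  rw [e, inner_neg_right, norm_neg] at a
  linarith

/-- One proximal step expanded. -/
lemma ppm_step {E : Type*} [NormedAddCommGroup E] [InnerProductSpace ℝ E]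
    {η : ℝ} (hη : 0 < η) {u v p s : E} (h : v = u - η • p) :
    (1 / η) * ‖v - s‖ ^ 2 + 2 * ⟪p, v - s⟫ ≤ (1 / η) * ‖u - s‖ ^ 2 := by
  have e : u - s = (v - s) + η • p := by rw [h]; abel
  have n : ‖u - s‖ ^ 2 = ‖v - s‖ ^ 2 + 2 * (η * ⟪p, v - s⟫) + η ^ 2 * ‖p‖ ^ 2 := by
    rw [e, norm_add_sq_real, inner_smul_right, norm_smul, mul_pow, Real.norm_eq_abs, sq_abs,
      real_inner_comm]
  have n2 : (1 / η) * ‖u - s‖ ^ 2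
      = (1 / η) * ‖v - s‖ ^ 2 + 2 * ⟪p, v - s⟫ + η * ‖p‖ ^ 2 := by
    rw [n]; field_simp
  have : 0 ≤ η * ‖p‖ ^ 2 := by positivity
  linarith

/-- Convergence of the Proximal-Point Method (Theorem 9, iteration complexity). -/
theorem ppm_iteration_complexity
    {Ex Ey : Type*}
    [NormedAddCommGroup Ex] [InnerProductSpace ℝ Ex] [FiniteDimensional ℝ Ex]
    [NormedAddCommGroup Ey] [InnerProductSpace ℝ Ey] [FiniteDimensional ℝ Ey]
    (K : Ex →ₗ[ℝ] Ey) (Kt : Ey →ₗ[ℝ] Ex)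
    (hadj : ∀ (x : Ex) (y : Ey), ⟪K x, y⟫ = ⟪x, Kt y⟫)
    (G : Ex → ℝ) (μx : ℝ) (hμx : 0 < μx) (hG : StronglyConvexSubgrad G μx)
    (Fs : Ey → ℝ) (μy : ℝ) (hμy : 0 < μy) (hFs : StronglyConvexSubgrad Fs μy)
    (xstar : Ex) (ystar : Ey)
    (hoptx : IsSubgradientAt G (-(Kt ystar)) xstar)
    (hopty : IsSubgradientAt Fs (K xstar) ystar)
    (ηx ηy : ℝ) (hηx : 0 < ηx) (hηy : 0 < ηy)
    (x : ℕ → Ex) (y : ℕ → Ey) (g : ℕ → Ex) (h : ℕ → Ey)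
    (hg : ∀ k, IsSubgradientAt G (g k) (x (k + 1)))
    (hh : ∀ k, IsSubgradientAt Fs (h k) (y (k + 1)))
    (hxupd : ∀ k, x (k + 1) = x k - ηx • (g k + Kt (y (k + 1))))
    (hyupd : ∀ k, y (k + 1) = y k - ηy • (h k - K (x (k + 1))))
    (Δ : ℕ → ℝ)
    (hΔ : ∀ k, Δ k = (1 / ηx) * ‖x k - xstar‖ ^ 2 + (1 / ηy) * ‖y k - ystar‖ ^ 2) :
    ∀ ε : ℝ, 0 < ε → ∀ k : ℕ,
      (k : ℝ) ≥ (1 + 1 / min (2 * μx * ηx) (2 * μy * ηy)) * Real.log (1 / ε) →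
      Δ k ≤ ε * Δ 0 := by
  intro ε hε k hk
  set m := min (2 * μx * ηx) (2 * μy * ηy) with hm
  have hm0 : 0 < m := lt_min (by positivity) (by positivity)
  have hstep : ∀ k, (1 + m) * Δ (k + 1) ≤ Δ k := by
    intro k
    have a1 := ppm_mono hG (hg k) hoptx
    have a2 := ppm_mono hFs (hh k) hopty
    have b1 := ppm_step (s := xstar) hηx (hxupd k)
    have b2 := ppm_step (s := ystar) hηy (hyupd k)
    have c := hadj (x (k + 1) - xstar) (y (k + 1) - ystar)
    rw [real_inner_comm] at c
    have c' : ⟪Kt (y (k + 1)), x (k + 1) - xstar⟫ - ⟪Kt ystar, x (k + 1) - xstar⟫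
        = ⟪K (x (k + 1)), y (k + 1) - ystar⟫ - ⟪K xstar, y (k + 1) - ystar⟫ := by
      rw [← inner_sub_left, ← inner_sub_left, ← map_sub, ← map_sub,
        hadj, real_inner_comm]
    rw [inner_neg_left] at a1
    rw [inner_add_left] at b1
    rw [inner_sub_left] at b2
    have d1 : m * ((1 / ηx) * ‖x (k + 1) - xstar‖ ^ 2) ≤ 2 * μx * ‖x (k + 1) - xstar‖ ^ 2 := by
      calc _ ≤ (2 * μx * ηx) * ((1 / ηx) * ‖x (k + 1) - xstar‖ ^ 2) := by
            gcongr; exact min_le_left _ _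
        _ = _ := by field_simp
    have d2 : m * ((1 / ηy) * ‖y (k + 1) - ystar‖ ^ 2) ≤ 2 * μy * ‖y (k + 1) - ystar‖ ^ 2 := by
      calc _ ≤ (2 * μy * ηy) * ((1 / ηy) * ‖y (k + 1) - ystar‖ ^ 2) := by
            gcongr; exact min_le_right _ _
        _ = _ := by field_simp
    rw [hΔ, hΔ]
    linarith
  have hpow : ∀ k, (1 + m) ^ k * Δ k ≤ Δ 0 := by
    intro k
    induction k with
    | zero => simp
    | succ n ih =>
      have := mul_le_mul_of_nonneg_left (hstep n) (by positivity : 0 ≤ (1 + m) ^ n)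
      rw [pow_succ]
      linarith
  have hΔk : 0 ≤ Δ k := by rw [hΔ]; positivity
  have hlog : m / (1 + m) ≤ Real.log (1 + m) := by
    have := Real.one_sub_inv_le_log_of_pos (by positivity : 0 < 1 + m)
    calc m / (1 + m) = 1 - (1 + m)⁻¹ := by field_simp; ring
      _ ≤ _ := this
  have hk2 : Real.log (1 / ε) ≤ k * Real.log (1 + m) := by
    calc Real.log (1 / ε) = ((1 + 1 / m) * Real.log (1 / ε)) * (m / (1 + m)) := by
          field_simp; ring
      _ ≤ k * (m / (1 + m)) := by gcongr
      _ ≤ _ := by gcongr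
  rw [← Real.log_pow, Real.log_le_log_iff (by positivity) (by positivity)] at hk2
  have h1 : 1 ≤ ε * (1 + m) ^ k := by
    rw [div_le_iff₀ hε] at hk2; linarith
  calc Δ k ≤ (ε * (1 + m) ^ k) * Δ k := le_mul_of_one_le_left hΔk h1
    _ = ε * ((1 + m) ^ k * Δ k) := by ring
    _ ≤ ε * Δ 0 := by gcongr; exact hpow k
end

section
/- (Convergence of APDA with Inexact Prox, Theorem 21.) Let G be differentiable, μ_x-strongly convex and L_x-smooth, F* be convex, L_xy > 0 satisfy ‖K x‖ ≤ L_xy‖x‖ for all x, and let 0 < μ_xy ≤ L_xy satisfy ‖K^⊤(y − y*)‖ ≥ μ_xy‖y − y*‖ for all y ∈ E_y. Suppose (x*, y*) satisfies ∇G(x*) + K^⊤y* = 0 and K x* ∈ ∂F*(y*). Set η_x = (1/(4√(L_xμ_x)))·(μ_xy/L_xy), η_y = √(L_xμ_x)/(8L_xyμ_xy), β_y = min{1/L_x, 1/(2L_xy²η_y)}, and θ = max{2/(2 + μ_xη_x), 1 − μ_xy²β_yη_y}. Let sequences (x^k), (x̂^k), (y^k), (ȳ^k) and subgradients h^k ∈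 ∂F*(y^{k+1}) satisfy, for all k ≥ 0: x^{k+1} = x^k − η_x(∇G(x̂^k) + K^⊤ȳ^k); y^{k+1} = y^k − η_y(h^k − K x̂^k) − η_yβ_yK(K^⊤y^k + ∇G(x̂^k)); ȳ^0 = y^0; ȳ^{k+1} = y^{k+1} + θ(y^{k+1} − y^k). For each k define Ψ^k(u) := G(u) + (1/(2η_x))‖u − (x^k − η_xK^⊤ȳ^k)‖² with gradient ∇Ψ^k(u) = ∇G(u) + K^⊤ȳ^k + (1/η_x)(u − x^k), let w*^k be its unique minimizer, and assume the inexactness bound ‖∇Ψ^k(x̂^k)‖² ≤ (1 + η_xL_x)² ‖x^k − w*^k‖² / (20 (1 + √(L_x/μ_x))² η_x²). Define, for k ≥ 0, Δ^{k+1} := (1 + μ_xη_x/2)(1/η_x)‖x^{k+1} − x*‖² + (1/η_y)‖y^{k+1} − y*‖² + (1/(2η_y))‖y^{k+1} − y^k‖² + (1/(8η_x))‖x^k − w*^k‖² − 2⟨K^⊤y^{k+1} − K^⊤y^k, x̂^k − x*⟩, and Δ^0 := (1 + μ_xη_x/2)(1/η_x)‖x^0 − x*‖² + (1/η_y)‖y^0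 − y*‖². Then for all k ≥ 0: (1/(2η_x))‖x^{k+1} − x*‖² + (1/η_y)‖y^{k+1} − y*‖² ≤ Δ^{k+1}, and Δ^{k+1} ≤ θ Δ^k; in particular Δ^k ≤ θ^k Δ^0. -/
open RealInnerProductSpace

section helpers
variable {E F : Type*} [NormedAddCommGroup E] [InnerProductSpace ℝ E]
  [NormedAddCommGroup F] [InnerProductSpace ℝ F]

lemma apda_descent [CompleteSpace E] (G : E → ℝ) (G' : E → E) (hgrad : ∀ u, HasGradientAt G (G' u) u)
    (L : ℝ) (hs : ∀ u v, ‖G' u - G' v‖ ≤ L * ‖u - v‖) (u v : E) :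
    G v ≤ G u + ⟪G' u, v - u⟫ + L / 2 * ‖v - u‖ ^ 2 := by
  set d := v - u with hd
  have hder : ∀ t : ℝ, HasDerivAt (fun t : ℝ => G (u + t • d) - t * ⟪G' u, d⟫ - L / 2 * ‖d‖ ^ 2 * t ^ 2)
      (⟪G' (u + t • d), d⟫ - ⟪G' u, d⟫ - L / 2 * ‖d‖ ^ 2 * (2 * t)) t := by
    intro t
    have h1 : HasDerivAt (fun t : ℝ => u + t • d) d t := by
      simpa using ((hasDerivAt_id t).smul_const d).const_add u
    have h2 := (hgrad (u + t • d)).hasFDerivAt.comp_hasDerivAt t h1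
    have h3 : HasDerivAt (fun t : ℝ => t * ⟪G' u, d⟫) ⟪G' u, d⟫ t := by
      simpa using (hasDerivAt_id t).mul_const ⟪G' u, d⟫
    have h4 : HasDerivAt (fun t : ℝ => L / 2 * ‖d‖ ^ 2 * t ^ 2) (L / 2 * ‖d‖ ^ 2 * (2 * t)) t := by
      simpa using (hasDerivAt_pow 2 t).const_mul (L / 2 * ‖d‖ ^ 2)
    have h5 := (h2.sub h3).sub h4
    have h6 : HasDerivAt (fun t : ℝ => G (u + t • d) - t * ⟪G' u, d⟫ - L / 2 * ‖d‖ ^ 2 * t ^ 2)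
      _ t := h5
    convert h6 using 1
    rw [InnerProductSpace.toDual_apply_apply]
  have hanti : AntitoneOn (fun t : ℝ => G (u + t • d) - t * ⟪G' u, d⟫ - L / 2 * ‖d‖ ^ 2 * t ^ 2)
      (Set.Ici 0) := by
    apply antitoneOn_of_deriv_nonpos (convex_Ici 0)
    · exact fun t _ => (hder t).continuousAt.continuousWithinAt
    · exact fun t _ => (hder t).differentiableAt.differentiableWithinAt
    · intro t ht
      rw [interior_Ici] at ht
      have ht : 0 < t := ht
      rw [(hder t).deriv]
      have h1 : ⟪G' (u + t • d) - G' u, d⟫ ≤ ‖G' (u + t • d) - G' u‖ * ‖d‖ := real_inner_le_norm _ _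
      have h2 := hs (u + t • d) u
      have h3 : ‖u + t • d - u‖ = t * ‖d‖ := by
        rw [add_sub_cancel_left, norm_smul, Real.norm_of_nonneg ht.le]
      rw [h3] at h2
      rw [inner_sub_left] at h1
      nlinarith [mul_le_mul_of_nonneg_right h2 (norm_nonneg d)]
  have := hanti (a := 0) (b := 1) (by simp) (by simp) zero_le_one
  simp [hd] at this
  simp [hd]
  linarith

lemma apda_coco [CompleteSpace E] (G : E → ℝ) (G' : E → E) (hgrad : ∀ u, HasGradientAt G (G' u) u)
    (μ : ℝ) (hμ : 0 < μ)
    (hsc : ∀ u v, G u + ⟪G' u, v - u⟫ + μ / 2 * ‖v - u‖ ^ 2 ≤ G v)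
    (L : ℝ) (hL : 0 < L) (hs : ∀ u v, ‖G' u - G' v‖ ≤ L * ‖u - v‖) (u v : E) :
    μ / 2 * ‖u - v‖ ^ 2 + 1 / (2 * L) * ‖G' u - G' v‖ ^ 2 ≤ ⟪G' u - G' v, u - v⟫ := by
  set g := G' u - G' v with hg
  have h1 := hsc u v
  have h2 := apda_descent G G' hgrad L hs u (u - (1 / L) • g)
  have h3 := hsc v (u - (1 / L) • g)
  have e1 : u - (1 / L) • g - u = -((1 / L) • g) := by abel
  have e2 : u - (1 / L) • g - v = (u - v) - (1 / L) • g := by abel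
  have e3 : v - u = -(u - v) := by abel
  have hp : 0 ≤ μ / 2 * ‖u - (1 / L) • g - v‖ ^ 2 := by positivity
  rw [e1] at h2
  have hgg : ⟪G' u, g⟫ - ⟪G' v, g⟫ = ‖g‖ ^ 2 := by
    rw [← inner_sub_left, ← hg, real_inner_self_eq_norm_sq]
  have hi : ⟪g, u - v⟫ = ⟪G' u, u - v⟫ - ⟪G' v, u - v⟫ := by rw [← inner_sub_left]
  rw [norm_neg, norm_smul, inner_neg_right, inner_smul_right, mul_pow, Real.norm_of_nonneg (by positivity)] at h2
  rw [e3, norm_neg, inner_neg_right] at h1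
  have h3' : G v + (⟪G' v, u - v⟫ - 1 / L * ⟪G' v, g⟫) ≤ G (u - (1 / L) • g) := by
    rw [← inner_smul_right, ← inner_sub_right, ← e2]; linarith
  have e4 : L / 2 * ((1 / L) ^ 2 * ‖g‖ ^ 2) = 1 / (2 * L) * ‖g‖ ^ 2 := by field_simp
  have e5 : 1 / L * ⟪G' u, g⟫ - 1 / L * ⟪G' v, g⟫ = 2 * (1 / (2 * L) * ‖g‖ ^ 2) := by
    rw [← mul_sub, hgg]; field_simp
  rw [e4] at h2
  rw [hi]
  linarith

lemma apda_Kt (K : E →ₗ[ℝ] F) (Kt : F →ₗ[ℝ] E)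
    (hadj : ∀ (x : E) (y : F), ⟪K x, y⟫ = ⟪x, Kt y⟫)
    (L : ℝ) (hL : 0 < L) (hK : ∀ x : E, ‖K x‖ ≤ L * ‖x‖) (y : F) : ‖Kt y‖ ≤ L * ‖y‖ := by
  have h1 : ‖Kt y‖ ^ 2 ≤ L * ‖Kt y‖ * ‖y‖ := by
    rw [← real_inner_self_eq_norm_sq, ← hadj]
    exact (real_inner_le_norm _ _).trans (mul_le_mul_of_nonneg_right (hK _) (norm_nonneg _))
  rcases (norm_nonneg (Kt y)).eq_or_lt with h | h
  · rw [← h]; positivity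
  · nlinarith

lemma apda_norm_sub_sq (u v z : E) : ‖u - z‖ ^ 2 - ‖v - z‖ ^ 2
    = 2 * ⟪u - v, u - z⟫ - ‖u - v‖ ^ 2 := by
  have : v - z = (u - z) - (u - v) := by abel
  rw [this, norm_sub_sq_real (u - z) (u - v), real_inner_comm]; ring

lemma apda_two (u v : E) : ‖u + v‖ ^ 2 ≤ 2 * ‖u‖ ^ 2 + 2 * ‖v‖ ^ 2 := by
  have h1 := norm_add_sq_real u v
  have h2 := norm_sub_sq_real u v
  nlinarith [sq_nonneg ‖u - v‖]

/-- Young: cross-term bound -/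
lemma apda_cross (Kt : F →ₗ[ℝ] E) (L : ℝ) (hL : 0 < L) (hKt : ∀ y, ‖Kt y‖ ≤ L * ‖y‖)
    (a b : ℝ) (ha : 0 < a) (hb : 0 < b) (hab : a * b = 32 * L ^ 2) (d : F) (z : E) :
    2 * |⟪Kt d, z⟫| ≤ b / 2 * ‖d‖ ^ 2 + a / 16 * ‖z‖ ^ 2 := by
  have h1 : |⟪Kt d, z⟫| ≤ L * ‖d‖ * ‖z‖ :=
    (abs_real_inner_le_norm _ _).trans (mul_le_mul_of_nonneg_right (hKt _) (norm_nonneg _))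
  have h2 : 0 ≤ (b * ‖d‖ - 2 * L * ‖z‖) ^ 2 := sq_nonneg _
  have h3 : b * (2 * (L * ‖d‖ * ‖z‖)) ≤ b * (b / 2 * ‖d‖ ^ 2 + a / 16 * ‖z‖ ^ 2) := by
    have : b * (a / 16 * ‖z‖ ^ 2) = 2 * L ^ 2 * ‖z‖ ^ 2 := by
      linear_combination (‖z‖ ^ 2 / 16) * hab
    rw [mul_add, this]; nlinarith
  have := le_of_mul_le_mul_left h3 hb
  linarith

lemma apda_prim (a μ : ℝ) (ha : 0 < a) (hμ : 0 < μ)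
    (x xh xp xs c g : E) (L : ℝ)
    (hupd : a • (xp - x) = -c)
    (hco : μ / 2 * ‖xh - xs‖ ^ 2 + 1 / (2 * L) * ‖g‖ ^ 2 ≤ ⟪g, xh - xs⟫) :
    (a + μ / 2) * ‖xp - xs‖ ^ 2 ≤ a * ‖x - xs‖ ^ 2 - 2 * ⟪c - g, xh - xs⟫ - 1 / L * ‖g‖ ^ 2
      + (a + μ) * ‖xp - xh‖ ^ 2 - a * ‖x - xh‖ ^ 2 := by
  have h1 : ‖xp - xs‖ ^ 2 - ‖x - xs‖ ^ 2 = 2 * ⟪xp - x, xh - xs⟫ + ‖xp - xh‖ ^ 2 - ‖x - xh‖ ^ 2 := by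
    have e1 : xp - xs = (xp - xh) + (xh - xs) := by abel
    have e2 : x - xs = (x - xh) + (xh - xs) := by abel
    have e3 : xp - x = (xp - xh) - (x - xh) := by abel
    rw [e1, e2, e3, norm_add_sq_real, norm_add_sq_real, inner_sub_left (xp - xh)]; ring
  have h2 : a * ⟪xp - x, xh - xs⟫ = -⟪c, xh - xs⟫ := by
    rw [← real_inner_smul_left, hupd, inner_neg_left]
  have h3 : ‖xp - xs‖ ^ 2 ≤ 2 * ‖xp - xh‖ ^ 2 + 2 * ‖xh - xs‖ ^ 2 := by
    have := apda_two (xp - xh) (xh - xs)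
    rwa [sub_add_sub_cancel] at this
  have e : 1 / L * ‖g‖ ^ 2 = 2 * (1 / (2 * L) * ‖g‖ ^ 2) := by
    have : 1 / L = 2 * (1 / (2 * L)) := by rw [one_div, one_div, mul_inv]; ring
    rw [this]; ring
  rw [e, inner_sub_left]
  nlinarith

lemma apda_dual (K : E →ₗ[ℝ] F) (Kt : F →ₗ[ℝ] E)
    (hadj : ∀ (x : E) (y : F), ⟪K x, y⟫ = ⟪x, Kt y⟫)
    (L : ℝ) (hL : 0 < L) (hKtL : ∀ y, ‖Kt y‖ ≤ L * ‖y‖)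
    (b β m : ℝ) (hβ : 0 ≤ β) (hbβ : β * L ^ 2 ≤ b / 2) (hm : 0 < m)
    (yc yp ys h : F) (xh xs g : E)
    (hlow : m * ‖yc - ys‖ ≤ ‖Kt (yc - ys)‖)
    (hmono : 0 ≤ ⟪h - K xs, yp - ys⟫)
    (hupd : b • (yp - yc) = -(h - K xh) - β • K (Kt (yc - ys) + g)) :
    b * ‖yp - ys‖ ^ 2 ≤ (b - β * m ^ 2) * ‖yc - ys‖ ^ 2 - b / 2 * ‖yp - yc‖ ^ 2
      + 2 * ⟪xh - xs, Kt (yp - ys)⟫ + β * ‖g‖ ^ 2 := by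
  have h1 := apda_norm_sub_sq yp yc ys
  have h2 : b * ⟪yp - yc, yp - ys⟫ = -⟪h - K xs, yp - ys⟫ + ⟪xh - xs, Kt (yp - ys)⟫
      - β * ⟪Kt (yc - ys) + g, Kt (yp - ys)⟫ := by
    rw [← real_inner_smul_left, hupd, ← hadj, ← hadj, ← real_inner_smul_left, ← inner_neg_left,
      ← inner_add_left, ← inner_sub_left, map_sub K]
    congr 1; abel
  have e : Kt (yp - ys) = Kt (yc - ys) + Kt (yp - yc) := by
    rw [← map_add]; congr 1; abel
  set p := Kt (yc - ys) with hp
  set d := Kt (yp - yc) with hd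
  have h3 : ‖p‖ ^ 2 - ‖g‖ ^ 2 - ‖d‖ ^ 2 ≤ 2 * ⟪p + g, p + d⟫ := by
    have n1 := norm_add_sq_real p g
    have n2 := norm_add_sq_real (p + g) d
    have n3 : ⟪p + g, p + d⟫ = ‖p‖ ^ 2 + ⟪p, g⟫ + ⟪p + g, d⟫ := by
      rw [inner_add_right, inner_add_left, real_inner_self_eq_norm_sq, real_inner_comm]
    nlinarith [sq_nonneg ‖p + g + d‖]
  have h4 : m ^ 2 * ‖yc - ys‖ ^ 2 ≤ ‖p‖ ^ 2 := by
    rw [← mul_pow]; exact pow_le_pow_left₀ (by positivity) hlow 2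
  have h5 : ‖d‖ ^ 2 ≤ L ^ 2 * ‖yp - yc‖ ^ 2 := by
    rw [← mul_pow]; exact pow_le_pow_left₀ (by positivity) (hKtL _) 2
  have h6 := mul_le_mul_of_nonneg_right hbβ (sq_nonneg ‖yp - yc‖)
  have h7 := mul_le_mul_of_nonneg_left h3 hβ
  have h8 := mul_le_mul_of_nonneg_left h4 hβ
  have h9 := mul_le_mul_of_nonneg_left h5 hβ
  rw [← e] at h7
  have h10 : b * (‖yp - ys‖ ^ 2 - ‖yc - ys‖ ^ 2) = b * (2 * ⟪yp - yc, yp - ys⟫ - ‖yp - yc‖ ^ 2) := by rw [h1]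
  linarith

end helpers

set_option maxHeartbeats 4000000 in
/-- Convergence of APDA with Inexact Prox (Theorem 21). -/
theorem apda_inexact_prox_convergence
    {Ex Ey : Type*}
    [NormedAddCommGroup Ex] [InnerProductSpace ℝ Ex] [FiniteDimensional ℝ Ex]
    [NormedAddCommGroup Ey] [InnerProductSpace ℝ Ey] [FiniteDimensional ℝ Ey]
    (K : Ex →ₗ[ℝ] Ey) (Kt : Ey →ₗ[ℝ] Ex)
    (hadj : ∀ (x : Ex) (y : Ey), ⟪K x, y⟫ = ⟪x, Kt y⟫)
    (Lxy : ℝ) (hLxy : 0 < Lxy) (hK : ∀ x : Ex, ‖K x‖ ≤ Lxy * ‖x‖)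
    (G : Ex → ℝ) (G' : Ex → Ex)
    (hgrad : ∀ u, HasGradientAt G (G' u) u)
    (μx : ℝ) (hμx : 0 < μx)
    (hsc : ∀ u v, G u + ⟪G' u, v - u⟫ + μx / 2 * ‖v - u‖ ^ 2 ≤ G v)
    (Lx : ℝ) (hLx : 0 < Lx)
    (hsmooth : ∀ u v, ‖G' u - G' v‖ ≤ Lx * ‖u - v‖)
    (Fs : Ey → ℝ) (hFs : ConvexOn ℝ Set.univ Fs)
    (xstar : Ex) (ystar : Ey)
    (μxy : ℝ) (hμxy : 0 < μxy) (hμxyL : μxy ≤ Lxy)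
    (hKt : ∀ y : Ey, ‖Kt (y - ystar)‖ ≥ μxy * ‖y - ystar‖)
    (hoptx : G' xstar + Kt ystar = 0)
    (hopty : IsSubgradientAt Fs (K xstar) ystar)
    (ηx ηy βy θ : ℝ)
    (hηx : ηx = (1 / (4 * Real.sqrt (Lx * μx))) * (μxy / Lxy))
    (hηy : ηy = Real.sqrt (Lx * μx) / (8 * Lxy * μxy))
    (hβy : βy = min (1 / Lx) (1 / (2 * Lxy ^ 2 * ηy)))
    (hθ : θ = max (2 / (2 + μx * ηx)) (1 - μxy ^ 2 * βy * ηy))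
    (x xhat : ℕ → Ex) (y ybar : ℕ → Ey) (h : ℕ → Ey)
    (hh : ∀ k, IsSubgradientAt Fs (h k) (y (k + 1)))
    (hxupd : ∀ k, x (k + 1) = x k - ηx • (G' (xhat k) + Kt (ybar k)))
    (hyupd : ∀ k, y (k + 1) = y k - ηy • (h k - K (xhat k))
        - (ηy * βy) • K (Kt (y k) + G' (xhat k)))
    (hybar0 : ybar 0 = y 0)
    (hybarupd : ∀ k, ybar (k + 1) = y (k + 1) + θ • (y (k + 1) - y k))
    (Ψ : ℕ → Ex → ℝ)
    (hΨ : ∀ k u, Ψ k u = G u + (1 / (2 * ηx)) * ‖u - (x k - ηx • Kt (ybar k))‖ ^ 2)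
    (Ψ' : ℕ → Ex → Ex)
    (hΨ' : ∀ k u, Ψ' k u = G' u + Kt (ybar k) + (1 / ηx) • (u - x k))
    (w : ℕ → Ex) (hw : ∀ k u, Ψ k (w k) ≤ Ψ k u)
    (hinexact : ∀ k, ‖Ψ' k (xhat k)‖ ^ 2 ≤
        (1 + ηx * Lx) ^ 2 * ‖x k - w k‖ ^ 2
          / (20 * (1 + Real.sqrt (Lx / μx)) ^ 2 * ηx ^ 2))
    (Δ : ℕ → ℝ)
    (hΔ0 : Δ 0 = (1 + μx * ηx / 2) * (1 / ηx) * ‖x 0 - xstar‖ ^ 2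
        + (1 / ηy) * ‖y 0 - ystar‖ ^ 2)
    (hΔ : ∀ k, Δ (k + 1) =
        (1 + μx * ηx / 2) * (1 / ηx) * ‖x (k + 1) - xstar‖ ^ 2
        + (1 / ηy) * ‖y (k + 1) - ystar‖ ^ 2
        + (1 / (2 * ηy)) * ‖y (k + 1) - y k‖ ^ 2
        + (1 / (8 * ηx)) * ‖x k - w k‖ ^ 2
        - 2 * ⟪Kt (y (k + 1)) - Kt (y k), xhat k - xstar⟫) :
    ∀ k,
      ((1 / (2 * ηx)) * ‖x (k + 1) - xstar‖ ^ 2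
          + (1 / ηy) * ‖y (k + 1) - ystar‖ ^ 2 ≤ Δ (k + 1))
      ∧ Δ (k + 1) ≤ θ * Δ k
      ∧ Δ k ≤ θ ^ k * Δ 0 := by
  have hq : 0 < Real.sqrt (Lx * μx) := Real.sqrt_pos.mpr (by positivity)
  have hqq : Real.sqrt (Lx * μx) ^ 2 = Lx * μx := Real.sq_sqrt (by positivity)
  have hηx0 : 0 < ηx := by rw [hηx]; positivity
  have hηy0 : 0 < ηy := by rw [hηy]; positivity
  have hβ0 : 0 < βy := by rw [hβy]; exact lt_min (by positivity) (by positivity)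
  have hβL : βy ≤ 1 / Lx := by rw [hβy]; exact min_le_left _ _
  have hβ2 : βy ≤ 1 / (2 * Lxy ^ 2 * ηy) := by rw [hβy]; exact min_le_right _ _
  obtain ⟨a, ha⟩ : ∃ a, a = 1 / ηx := ⟨_, rfl⟩
  obtain ⟨b, hb⟩ : ∃ b, b = 1 / ηy := ⟨_, rfl⟩
  have ha0 : 0 < a := by rw [ha]; positivity
  have hb0 : 0 < b := by rw [hb]; positivity
  have haη : a * ηx = 1 := by rw [ha]; field_simp
  have hbη : b * ηy = 1 := by rw [hb]; field_simp
  have hab : a * b = 32 * Lxy ^ 2 := by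
    rw [ha, hb, hηx, hηy]; field_simp; ring
  have hbβ : βy * Lxy ^ 2 ≤ b / 2 := by
    calc βy * Lxy ^ 2 ≤ 1 / (2 * Lxy ^ 2 * ηy) * Lxy ^ 2 := by gcongr
      _ = b / 2 := by rw [hb]; field_simp
  have hKtL := apda_Kt K Kt hadj Lxy hLxy hK
  have hcr := apda_cross Kt Lxy hLxy hKtL a b ha0 hb0 hab
  -- θ facts
  have hθ1 : θ ≤ 1 := by
    rw [hθ]; apply max_le
    · rw [div_le_one (by positivity)]; first | linarith [mul_pos hμx hηx0] | nlinarith [mul_pos hμx hηx0]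
    · have : 0 < μxy ^ 2 * βy * ηy := by positivity
      linarith
  have hθa : a ≤ θ * (a + μx / 2) := by
    have h1 : 2 / (2 + μx * ηx) ≤ θ := by rw [hθ]; exact le_max_left _ _
    calc a = 2 / (2 + μx * ηx) * (a + μx / 2) := by rw [ha]; field_simp
      _ ≤ _ := by gcongr
  have hθ0 : 0 ≤ θ := by
    have h1 : 2 / (2 + μx * ηx) ≤ θ := by rw [hθ]; exact le_max_left _ _
    exact le_trans (by positivity) h1
  have hθb : b - βy * μxy ^ 2 ≤ θ * b := by
    have h1 : 1 - μxy ^ 2 * βy * ηy ≤ θ := by rw [hθ]; exact le_max_right _ _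
    calc b - βy * μxy ^ 2 = (1 - μxy ^ 2 * βy * ηy) * b := by rw [hb]; field_simp
      _ ≤ _ := by gcongr
  -- μx ηx ≤ 1/4 effectively
  have hμη : ∀ u : Ex, μx * ‖u‖ ^ 2 ≤ a * ‖u‖ ^ 2 / 4 := by
    intro u
    by_cases hc : μx ≤ Lx
    · have h1 : μx ≤ Real.sqrt (Lx * μx) := Real.le_sqrt_of_sq_le (by nlinarith)
      have h2 : a = 4 * Real.sqrt (Lx * μx) * (Lxy / μxy) := by
        rw [ha, hηx]; field_simp
      have h3 : 1 ≤ Lxy / μxy := by rwa [one_le_div hμxy]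
      have h4 : μx ≤ a / 4 := by rw [h2]; first | linarith | nlinarith
      first | linarith [mul_le_mul_of_nonneg_right h4 (sq_nonneg ‖u‖)] | nlinarith [mul_le_mul_of_nonneg_right h4 (sq_nonneg ‖u‖)]
    · have h1 := apda_coco G G' hgrad μx hμx hsc Lx hLx hsmooth u 0
      have h2 := hsc u 0
      have h3 := hsc 0 u
      have h4 := (real_inner_le_norm (G' u - G' 0) (u - 0)).trans
        (mul_le_mul_of_nonneg_right (hsmooth u 0) (norm_nonneg _))
      rw [inner_sub_left] at h4
      simp only [zero_sub, sub_zero, inner_neg_right, norm_neg] at h2 h3 h4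
      have h5 : ‖u‖ ^ 2 = 0 := by
        have : (μx - Lx) * ‖u‖ ^ 2 ≤ 0 := by first | linarith | nlinarith
        have := sq_nonneg ‖u‖
        first | linarith | nlinarith
      rw [h5]; simp
  -- inexactness
  have hxp : ∀ k, x (k + 1) - xhat k = -(ηx • Ψ' k (xhat k)) := by
    intro k
    rw [hxupd, hΨ', smul_add ηx (G' (xhat k) + Kt (ybar k)), smul_smul]
    have : ηx * (1 / ηx) = 1 := by field_simp
    rw [this, one_smul]; abel
  have hex : ∀ k, ‖x (k + 1) - xhat k‖ ^ 2 ≤ ‖x k - w k‖ ^ 2 / 20 := by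
    intro k
    rw [hxp, norm_neg, norm_smul, Real.norm_of_nonneg hηx0.le, mul_pow]
    have h1 : ηx * Lx ≤ Real.sqrt (Lx / μx) := by
      have h2 : Real.sqrt (Lx / μx) = Lx / Real.sqrt (Lx * μx) := by
        rw [Real.sqrt_eq_iff_mul_self_eq (by positivity) (by positivity)]
        field_simp; rw [hqq]
      have h3 : μxy / Lxy ≤ 1 := by rwa [div_le_one hLxy]
      rw [h2, hηx]
      calc 1 / (4 * √(Lx * μx)) * (μxy / Lxy) * Lx ≤ 1 / (4 * √(Lx * μx)) * 1 * Lx := by gcongr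
        _ = (Lx / √(Lx * μx)) / 4 := by field_simp
        _ ≤ _ := by
          have : 0 < Lx / √(Lx * μx) := by positivity
          linarith
    have hs0 := Real.sqrt_nonneg (Lx / μx)
    calc ηx ^ 2 * ‖Ψ' k (xhat k)‖ ^ 2 ≤ ηx ^ 2 * ((1 + ηx * Lx) ^ 2 * ‖x k - w k‖ ^ 2
          / (20 * (1 + Real.sqrt (Lx / μx)) ^ 2 * ηx ^ 2)) := by gcongr; exact hinexact k
      _ ≤ ηx ^ 2 * ((1 + √(Lx / μx)) ^ 2 * ‖x k - w k‖ ^ 2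
          / (20 * (1 + Real.sqrt (Lx / μx)) ^ 2 * ηx ^ 2)) := by gcongr
      _ = _ := by field_simp
  have hwb : ∀ k, ‖w k - xhat k‖ ≤ 2 * ‖x (k + 1) - xhat k‖ := by
    intro k
    have h1 := hw k (xhat k)
    rw [hΨ, hΨ] at h1
    have h2 := hsc (xhat k) (w k)
    set z := x k - ηx • Kt (ybar k) with hz
    have e1 : w k - z = (xhat k - z) + (w k - xhat k) := by abel
    have e2 : ⟪Ψ' k (xhat k), w k - xhat k⟫ = ⟪G' (xhat k), w k - xhat k⟫
        + 1 / ηx * ⟪xhat k - z, w k - xhat k⟫ := by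
      rw [← real_inner_smul_left, ← inner_add_left, hΨ', hz]
      congr 1
      rw [smul_sub, smul_sub, smul_sub, smul_smul]
      have : 1 / ηx * ηx = 1 := by field_simp
      rw [this, one_smul]; abel
    rw [e1, norm_add_sq_real] at h1
    have e3 : 1 / (2 * ηx) = a / 2 := by rw [ha]; field_simp
    rw [e3] at h1
    rw [← ha] at e2
    have h3 : ηx * ⟪Ψ' k (xhat k), w k - xhat k⟫ = -⟪x (k + 1) - xhat k, w k - xhat k⟫ := by
      rw [← real_inner_smul_left, hxp, inner_neg_left, neg_neg]
    have h4 := real_inner_le_norm (x (k + 1) - xhat k) (w k - xhat k)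
    have h5 : ⟪Ψ' k (xhat k), w k - xhat k⟫ + a / 2 * ‖w k - xhat k‖ ^ 2 ≤ 0 := by
      have : 0 ≤ μx / 2 * ‖w k - xhat k‖ ^ 2 := by positivity
      first | linarith | nlinarith
    have h6 : ηx * (⟪Ψ' k (xhat k), w k - xhat k⟫ + a / 2 * ‖w k - xhat k‖ ^ 2) ≤ 0 :=
      mul_nonpos_of_nonneg_of_nonpos hηx0.le h5
    have h7 : ηx * (a / 2 * ‖w k - xhat k‖ ^ 2) = ‖w k - xhat k‖ ^ 2 / 2 := by
      linear_combination (‖w k - xhat k‖ ^ 2 / 2) * haη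
    have h8 : ‖w k - xhat k‖ * ‖w k - xhat k‖ ≤ (2 * ‖x (k + 1) - xhat k‖) * ‖w k - xhat k‖ := by
      first | linarith | nlinarith
    rcases (norm_nonneg (w k - xhat k)).eq_or_lt with h0 | h0
    · rw [← h0]; positivity
    · exact le_of_mul_le_mul_right h8 h0
  have hxlow : ∀ k, 64 / 225 * ‖x k - w k‖ ^ 2 ≤ ‖x k - xhat k‖ ^ 2 := by
    intro k
    have h1 : ‖x k - w k‖ ≤ ‖x k - xhat k‖ + ‖w k - xhat k‖ := by
      rw [norm_sub_rev (w k)]; exact norm_sub_le_norm_sub_add_norm_sub _ _ _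
    have h2 : ‖w k - xhat k‖ ^ 2 ≤ 4 * ‖x (k + 1) - xhat k‖ ^ 2 := by
      have := pow_le_pow_left₀ (norm_nonneg _) (hwb k) 2
      linarith
    have h3 := hex k
    have h4 := pow_le_pow_left₀ (norm_nonneg _) h1 2
    first | linarith [sq_nonneg (5 * ‖x k - xhat k‖ - 4 * ‖w k - xhat k‖)] | nlinarith [sq_nonneg (5 * ‖x k - xhat k‖ - 4 * ‖w k - xhat k‖)]
  have e2 : 1 / (2 * ηx) = a / 2 := by rw [ha]; field_simp
  have e3 : 1 / (2 * ηy) = b / 2 := by rw [hb]; field_simp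
  have e4 : 1 / (8 * ηx) = a / 8 := by rw [ha]; field_simp
  have e1 : (1 + μx * ηx / 2) * (1 / ηx) = a + μx / 2 := by rw [ha]; field_simp
  rw [e1, ← hb] at hΔ0
  rw [e1, ← hb, e3, e4] at hΔ
  -- one step
  have step : ∀ k (yp : Ey) (xhp : Ex) (P : ℝ), ybar k = y k + θ • (y k - yp) →
      ‖x k - xhp‖ ^ 2 ≤ P → Δ (k + 1) ≤ θ * ((a + μx / 2) * ‖x k - xstar‖ ^ 2
        + b * ‖y k - ystar‖ ^ 2 + b / 2 * ‖y k - yp‖ ^ 2 + a / 8 * P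
        - 2 * ⟪Kt (y k) - Kt yp, xhp - xstar⟫) := by
    intro k yp xhp P hyb hP
    have hco := apda_coco G G' hgrad μx hμx hsc Lx hLx hsmooth (xhat k) xstar
    have hG : G' xstar = -Kt ystar := eq_neg_of_add_eq_zero_left hoptx
    have hprim := apda_prim a μx ha0 hμx (x k) (xhat k) (x (k + 1)) xstar
      (G' (xhat k) + Kt (ybar k)) (G' (xhat k) - G' xstar) Lx (by
        rw [hxupd, sub_sub_cancel_left, smul_neg, smul_smul, haη, one_smul]) hco
    have hdual := apda_dual K Kt hadj Lxy hLxy hKtL b βy μxy hβ0.le hbβ hμxy (y k) (y (k + 1))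
      ystar (h k) (xhat k) xstar (G' (xhat k) - G' xstar) (hKt _) (by
        have h1 := hh k ystar
        have h2 := hopty (y (k + 1))
        rw [← neg_sub, inner_neg_right] at h1
        rw [inner_sub_left]; linarith) (by
        have : Kt (y k - ystar) + (G' (xhat k) - G' xstar) = Kt (y k) + G' (xhat k) := by
          rw [hG, map_sub]; abel
        rw [this, hyupd]
        have : y k - ηy • (h k - K (xhat k)) - (ηy * βy) • K (Kt (y k) + G' (xhat k)) - y k
          = -(ηy • (h k - K (xhat k))) - ηy • βy • K (Kt (y k) + G' (xhat k)) := by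
          rw [smul_smul]; abel
        rw [this, smul_sub, smul_neg, smul_smul, smul_smul, hbη, one_smul, one_smul])
    have hg : βy * ‖G' (xhat k) - G' xstar‖ ^ 2 ≤ 1 / Lx * ‖G' (xhat k) - G' xstar‖ ^ 2 := by
      gcongr
    have hcross : ⟪G' (xhat k) + Kt (ybar k) - (G' (xhat k) - G' xstar), xhat k - xstar⟫
        = ⟪xhat k - xstar, Kt (y (k + 1) - ystar)⟫
          - ⟪Kt (y (k + 1)) - Kt (y k), xhat k - xstar⟫
          + θ * ⟪Kt (y k) - Kt yp, xhp - xstar⟫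
          + θ * ⟪Kt (y k - yp), xhat k - xhp⟫ := by
      have : G' (xhat k) + Kt (ybar k) - (G' (xhat k) - G' xstar)
          = Kt (y (k + 1) - ystar) - (Kt (y (k + 1)) - Kt (y k)) + θ • (Kt (y k) - Kt yp) := by
        rw [hG, hyb, map_add, map_smul, map_sub, map_sub]; abel
      rw [this, inner_add_left, inner_sub_left, real_inner_smul_left,
        real_inner_comm (xhat k - xstar), map_sub Kt (y k) yp]
      have : xhat k - xstar = (xhp - xstar) + (xhat k - xhp) := by abel
      rw [this, inner_add_right (Kt (y k) - Kt yp)]; ring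
    have hyoung := hcr (y k - yp) (xhat k - xhp)
    have hyoung' := neg_abs_le ⟪Kt (y k - yp), xhat k - xhp⟫
    have htwo : ‖xhat k - xhp‖ ^ 2 ≤ 2 * ‖x k - xhat k‖ ^ 2 + 2 * ‖x k - xhp‖ ^ 2 := by
      have := apda_two (xhat k - x k) (x k - xhp)
      rwa [sub_add_sub_cancel, norm_sub_rev (xhat k) (x k)] at this
    have hy2 : -2 * ⟪Kt (y k - yp), xhat k - xhp⟫ ≤ b / 2 * ‖y k - yp‖ ^ 2
        + a / 8 * ‖x k - xhat k‖ ^ 2 + a / 8 * P := by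
      have q1 := mul_le_mul_of_nonneg_left htwo ha0.le
      have q2 := mul_le_mul_of_nonneg_left hP ha0.le
      linarith
    have hy3 := mul_le_mul_of_nonneg_left hy2 hθ0
    have h1 := mul_le_mul_of_nonneg_right hθa (sq_nonneg ‖x k - xstar‖)
    have h2 := mul_le_mul_of_nonneg_right hθb (sq_nonneg ‖y k - ystar‖)
    have h3 : θ * (a / 8 * ‖x k - xhat k‖ ^ 2) ≤ a / 8 * ‖x k - xhat k‖ ^ 2 :=
      mul_le_of_le_one_left (by positivity) hθ1
    have h4 := mul_le_mul_of_nonneg_left (hxlow k) ha0.le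
    have h5 := mul_le_mul_of_nonneg_left (hex k) ha0.le
    have h6 := hμη (x (k + 1) - xhat k)
    have h7 : 0 ≤ a * ‖x k - w k‖ ^ 2 := by positivity
    rw [hcross] at hprim
    rw [hΔ]
    linarith
  have step' : ∀ k, Δ (k + 1) ≤ θ * Δ k := by
    intro k
    cases k with
    | zero =>
      have := step 0 (y 0) (x 0) 0 (by simp [hybar0]) (by simp)
      rw [hΔ0]
      simpa using this
    | succ k =>
      rw [hΔ k]
      refine step (k + 1) (y k) (xhat k) _ (hybarupd k) ?_
      have := hex k
      first | linarith [sq_nonneg ‖x k - w k‖] | nlinarith [sq_nonneg ‖x k - w k‖]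
  intro k
  refine ⟨?_, step' k, ?_⟩
  · rw [hΔ, e2, ← hb]
    have h1 := hcr (y (k + 1) - y k) (xhat k - xstar)
    have h2 := le_abs_self ⟪Kt (y (k + 1) - y k), xhat k - xstar⟫
    rw [map_sub] at h1 h2
    have h3 : ‖xhat k - xstar‖ ^ 2 ≤ 2 * ‖x (k + 1) - xhat k‖ ^ 2 + 2 * ‖x (k + 1) - xstar‖ ^ 2 := by
      have := apda_two (xhat k - x (k + 1)) (x (k + 1) - xstar)
      rwa [sub_add_sub_cancel, norm_sub_rev (xhat k) (x (k + 1))] at this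
    have h4 := mul_le_mul_of_nonneg_left h3 ha0.le
    have h5 := mul_le_mul_of_nonneg_left (hex k) ha0.le
    have h6 : 0 ≤ a * ‖x k - w k‖ ^ 2 := by positivity
    have h7 : 0 ≤ a * ‖x (k + 1) - xstar‖ ^ 2 := by positivity
    have h8 : 0 ≤ μx * ‖x (k + 1) - xstar‖ ^ 2 := by positivity
    linarith
  · induction k with
    | zero => simp
    | succ k ih =>
      calc Δ (k + 1) ≤ θ * Δ k := step' k
        _ ≤ θ * (θ ^ k * Δ 0) := by gcongr
        _ = _ := by ring
end

section
/- (Lemma 1(ii), key step: Fast GD followed by GD.) Let f : E → ℝ be convex, differentiable with gradient ∇f, and L-smooth (L > 0), and let x* be a minimizer of f. Let K ≥ 1 be a natural number, let x^0 ∈ E, and suppose a point x^K ∈ E satisfies f(x^K) − f(x*) ≤ 4L‖x^0 − x*‖²/K² (the guarantee of K iterations of Fast Gradient Descent started from x^0). Define x^{j+1} = x^j − (1/L)∇f(x^j) for j = K, K+1, …, 2K−1. Then ‖∇f(x^{2K})‖² ≤ 8L²‖x^0 − x*‖² / K³. -/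
open RealInnerProductSpace

theorem aux_line {E : Type*} [NormedAddCommGroup E] [InnerProductSpace ℝ E] [CompleteSpace E]
    (f : E → ℝ) (f' : E → E)
    (hgrad : ∀ u, HasGradientAt f (f' u) u) (u d : E) (t : ℝ) :
    HasDerivAt (fun t : ℝ => f (u + t • d)) ⟪f' (u + t • d), d⟫ t := by
  have h1 := (hgrad (u + t • d)).hasFDerivAt
  have h2 : HasDerivAt (fun t : ℝ => u + t • d) d t := by
    simpa using ((hasDerivAt_id t).smul_const d).const_add u
  have h3 := h1.comp_hasDerivAt t h2
  simpa [Function.comp_def] using h3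

theorem aux_first {E : Type*} [NormedAddCommGroup E] [InnerProductSpace ℝ E] [CompleteSpace E]
    (f : E → ℝ) (f' : E → E)
    (hgrad : ∀ u, HasGradientAt f (f' u) u) (hconv : ConvexOn ℝ Set.univ f) (u d : E) :
    f u + ⟪f' u, d⟫ ≤ f (u + d) := by
  have hc : ConvexOn ℝ Set.univ (fun t : ℝ => f (u + t • d)) := by
    refine ⟨convex_univ, fun a _ b _ p q hp hq hpq => ?_⟩
    have := hconv.2 (Set.mem_univ (u + a • d)) (Set.mem_univ (u + b • d)) hp hq hpq
    refine le_trans (le_of_eq ?_) this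
    show f _ = f _
    congr 1
    obtain rfl : q = 1 - p := by linarith
    simp only [smul_eq_mul]
    module
  have h := hc.le_slope_of_hasDerivAt (Set.mem_univ (0:ℝ)) (Set.mem_univ (1:ℝ)) one_pos
    (aux_line f f' hgrad u d 0)
  simp [slope_def_field] at h
  linarith

theorem aux_descent {E : Type*} [NormedAddCommGroup E] [InnerProductSpace ℝ E] [CompleteSpace E]
    (f : E → ℝ) (f' : E → E)
    (hgrad : ∀ u, HasGradientAt f (f' u) u) (L : ℝ)
    (hsmooth : ∀ u v, ‖f' u - f' v‖ ≤ L * ‖u - v‖) (u d : E) :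
    f (u + d) ≤ f u + ⟪f' u, d⟫ + L / 2 * ‖d‖ ^ 2 := by
  have hd : ∀ t : ℝ, HasDerivAt
      (fun t : ℝ => f (u + t • d) - (t * ⟪f' u, d⟫ + t ^ 2 * (L / 2 * ‖d‖ ^ 2)))
      (⟪f' (u + t • d), d⟫ - (⟪f' u, d⟫ + 2 * t * (L / 2 * ‖d‖ ^ 2))) t := by
    intro t
    refine (aux_line f f' hgrad u d t).sub (HasDerivAt.add ?_ ?_)
    · simpa using (hasDerivAt_id t).mul_const ⟪f' u, d⟫
    · simpa using (hasDerivAt_pow 2 t).mul_const (L / 2 * ‖d‖ ^ 2)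
  have hanti := antitoneOn_of_hasDerivWithinAt_nonpos (convex_Icc (0:ℝ) 1)
    (fun t _ => (hd t).continuousAt.continuousWithinAt)
    (fun t _ => (hd t).hasDerivWithinAt) (by
      intro t ht
      rw [interior_Icc] at ht
      have h1 := real_inner_le_norm (f' (u + t • d) - f' u) d
      have h2 := hsmooth (u + t • d) u
      rw [add_sub_cancel_left, norm_smul, Real.norm_of_nonneg ht.1.le] at h2
      rw [inner_sub_left] at h1
      have h3 := mul_le_mul_of_nonneg_right h2 (norm_nonneg d)
      nlinarith)
  have := hanti (a := 0) (b := 1) (by simp) (by simp) zero_le_one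
  simp at this
  linarith

theorem aux_coco {E : Type*} [NormedAddCommGroup E] [InnerProductSpace ℝ E] [CompleteSpace E]
    (f : E → ℝ) (f' : E → E)
    (hgrad : ∀ u, HasGradientAt f (f' u) u) (hconv : ConvexOn ℝ Set.univ f)
    (L : ℝ) (hL : 0 < L)
    (hsmooth : ∀ u v, ‖f' u - f' v‖ ≤ L * ‖u - v‖) (u v : E) :
    f u + ⟪f' u, v - u⟫ + 1 / (2 * L) * ‖f' v - f' u‖ ^ 2 ≤ f v := by
  have h1 := aux_descent f f' hgrad L hsmooth v (-(1 / L) • (f' v - f' u))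
  have h2 := aux_first f f' hgrad hconv u (v - u + -(1 / L) • (f' v - f' u))
  rw [show u + (v - u + -(1 / L) • (f' v - f' u)) = v + -(1 / L) • (f' v - f' u) by abel] at h2
  rw [inner_add_right, inner_smul_right] at h2
  rw [inner_smul_right, norm_smul, mul_pow] at h1
  have h3 : ‖f' v - f' u‖ ^ 2 = ⟪f' v, f' v - f' u⟫ - ⟪f' u, f' v - f' u⟫ := by
    rw [← inner_sub_left, real_inner_self_eq_norm_sq]
  have h4 : L / 2 * (‖-(1 / L)‖ ^ 2 * ‖f' v - f' u‖ ^ 2) = 1 / (2 * L) * ‖f' v - f' u‖ ^ 2 := by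
    rw [Real.norm_eq_abs, sq_abs]; field_simp
  have h5 : 1 / (2 * L) * ‖f' v - f' u‖ ^ 2 + 1 / (2 * L) * ‖f' v - f' u‖ ^ 2
      = 1 / L * (⟪f' v, f' v - f' u⟫ - ⟪f' u, f' v - f' u⟫) := by
    rw [← h3]; field_simp; ring
  linarith

/-- Lemma 1(ii), key step: Fast GD followed by GD. -/
theorem fgd_then_gd_gradient_norm_rate
    {E : Type*} [NormedAddCommGroup E] [InnerProductSpace ℝ E] [FiniteDimensional ℝ E]
    (f : E → ℝ) (f' : E → E)
    (hgrad : ∀ u, HasGradientAt f (f' u) u)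
    (hconv : ConvexOn ℝ Set.univ f)
    (L : ℝ) (hL : 0 < L)
    (hsmooth : ∀ u v, ‖f' u - f' v‖ ≤ L * ‖u - v‖)
    (xstar : E) (hmin : ∀ u, f xstar ≤ f u)
    (K : ℕ) (hK : 1 ≤ K)
    (x : ℕ → E)
    (hfgd : f (x K) - f xstar ≤ 4 * L * ‖x 0 - xstar‖ ^ 2 / (K : ℝ) ^ 2)
    (hupd : ∀ j, K ≤ j → j < 2 * K → x (j + 1) = x j - (1 / L) • f' (x j)) :
    ‖f' (x (2 * K))‖ ^ 2 ≤ 8 * L ^ 2 * ‖x 0 - xstar‖ ^ 2 / (K : ℝ) ^ 3 := by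
  have hmono : ∀ j, K ≤ j → j < 2 * K → ‖f' (x (j + 1))‖ ^ 2 ≤ ‖f' (x j)‖ ^ 2 := by
    intro j h1 h2
    have e := hupd j h1 h2
    have a := aux_coco f f' hgrad hconv L hL hsmooth (x j) (x (j + 1))
    have b := aux_coco f f' hgrad hconv L hL hsmooth (x (j + 1)) (x j)
    rw [show x (j + 1) - x j = -((1 / L) • f' (x j)) by rw [e]; abel, inner_neg_right,
      inner_smul_right, real_inner_self_eq_norm_sq, norm_sub_sq_real] at a
    rw [show x j - x (j + 1) = (1 / L) • f' (x j) by rw [e]; abel,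
      inner_smul_right, norm_sub_sq_real, real_inner_comm] at b
    rw [real_inner_comm] at a b
    have hp : 0 < 1 / L := by positivity
    have e2 : 1 / (2 * L) = 1 / L / 2 := by field_simp
    rw [e2] at a b
    have hc := real_inner_comm (f' (x j)) (f' (x (j + 1)))
    have c : 1 / L * (‖f' (x (j + 1))‖ ^ 2 - ⟪f' (x j), f' (x (j + 1))⟫) ≤ 0 := by
      rw [hc] at *
      nlinarith
    have c' : ‖f' (x (j + 1))‖ ^ 2 ≤ ⟪f' (x j), f' (x (j + 1))⟫ := by
      by_contra hh
      push Not at hh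
      nlinarith [mul_pos hp (sub_pos.2 hh)]
    have g := real_inner_le_norm (f' (x j)) (f' (x (j + 1)))
    nlinarith [sq_nonneg (‖f' (x j)‖ - ‖f' (x (j + 1))‖)]
  have hdec : ∀ j, K ≤ j → j < 2 * K →
      f (x (j + 1)) + 1 / (2 * L) * ‖f' (x j)‖ ^ 2 ≤ f (x j) := by
    intro j h1 h2
    have a := aux_descent f f' hgrad L hsmooth (x j) (-((1 / L) • f' (x j)))
    rw [← sub_eq_add_neg, ← hupd j h1 h2, inner_neg_right, inner_smul_right,
      real_inner_self_eq_norm_sq, norm_neg, norm_smul, mul_pow, Real.norm_eq_abs, sq_abs] at a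
    have e : L / 2 * ((1 / L) ^ 2 * ‖f' (x j)‖ ^ 2) = 1 / (2 * L) * ‖f' (x j)‖ ^ 2 := by
      field_simp
    have e2 : 1 / L * ‖f' (x j)‖ ^ 2
        = 1 / (2 * L) * ‖f' (x j)‖ ^ 2 + 1 / (2 * L) * ‖f' (x j)‖ ^ 2 := by
      field_simp; norm_num
    linarith
  have hind : ∀ m : ℕ, m ≤ K →
      f (x (K + m)) + m * (1 / (2 * L) * ‖f' (x (K + m))‖ ^ 2) ≤ f (x K) := by
    intro m
    induction m with
    | zero => simp
    | succ m ih =>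
      intro hm
      have i := ih (by omega)
      have a := hmono (K + m) (by omega) (by omega)
      have b := hdec (K + m) (by omega) (by omega)
      rw [← add_assoc]
      push_cast
      have hq : 0 ≤ 1 / (2 * L) := by positivity
      have a' := mul_le_mul_of_nonneg_left a hq
      have a'' := mul_le_mul_of_nonneg_left a' (by positivity : (0:ℝ) ≤ m + 1)
      linarith
  have h := hind K le_rfl
  rw [← two_mul] at h
  have h0 := hmin (x (2 * K))
  have hKp : (0:ℝ) < K := by exact_mod_cast hK
  have h1 : K * (1 / (2 * L) * ‖f' (x (2 * K))‖ ^ 2) ≤ 4 * L * ‖x 0 - xstar‖ ^ 2 / (K : ℝ) ^ 2 := by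
    linarith
  have h2 := mul_le_mul_of_nonneg_left h1 (by positivity : 0 ≤ 2 * L / K)
  calc _ = 2 * L / K * (K * (1 / (2 * L) * ‖f' (x (2 * K))‖ ^ 2)) := by field_simp
    _ ≤ _ := h2
    _ = _ := by field_simp; ring
end

section
/- (Final-gradient bound after K steps of Gradient Descent; building block for Lemma 1.) Let f : E → ℝ be convex, differentiable with gradient ∇f, and L-smooth (L > 0), and let x* be a minimizer of f. Let K ≥ 1 be a natural number, let x^K ∈ E be arbitrary, and define x^{j+1} = x^j − (1/L)∇f(x^j) for j = K, K+1, …, 2K−1. Then ‖∇f(x^{2K})‖² ≤ 2L (f(x^K) − f(x*)) / (K + 1). -/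
open RealInnerProductSpace

section helpers
variable {E : Type*} [NormedAddCommGroup E] [InnerProductSpace ℝ E] [FiniteDimensional ℝ E]

theorem gd_line_deriv (f : E → ℝ) (f' : E → E)
    (hgrad : ∀ u, HasGradientAt f (f' u) u) (u d : E) (t : ℝ) :
    HasDerivAt (fun t : ℝ => f (u + t • d)) (inner ℝ (f' (u + t • d)) d) t := by
  have h1 := (hgrad (u + t • d)).hasFDerivAt
  have h2 : HasDerivAt (fun t : ℝ => u + t • d) d t := by
    simpa using ((hasDerivAt_id t).smul_const d).const_add u
  have h3 := h1.comp_hasDerivAt t h2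
  simp only [InnerProductSpace.toDual_apply_apply] at h3
  exact h3

theorem gd_descent (f : E → ℝ) (f' : E → E)
    (hgrad : ∀ u, HasGradientAt f (f' u) u) (L : ℝ)
    (hsmooth : ∀ u v, ‖f' u - f' v‖ ≤ L * ‖u - v‖) (u d : E) :
    f (u + d) ≤ f u + inner ℝ (f' u) d + L / 2 * ‖d‖ ^ 2 := by
  have hd : ∀ t : ℝ, HasDerivAt
      (fun t : ℝ => f (u + t • d) - (t * inner ℝ (f' u) d + L / 2 * ‖d‖ ^ 2 * t ^ 2))
      (inner ℝ (f' (u + t • d)) d - (inner ℝ (f' u) d + L * ‖d‖ ^ 2 * t)) t := by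
    intro t
    have h1 := gd_line_deriv f f' hgrad u d t
    have h2 : HasDerivAt (fun t : ℝ => t * inner ℝ (f' u) d + L / 2 * ‖d‖ ^ 2 * t ^ 2)
        (1 * inner ℝ (f' u) d + L / 2 * ‖d‖ ^ 2 * (2 * t)) t := by
      have := ((hasDerivAt_id t).mul_const (inner ℝ (f' u) d)).add
        ((hasDerivAt_pow 2 t).const_mul (L / 2 * ‖d‖ ^ 2))
      exact this.congr_deriv (by simp)
    exact (h1.sub h2).congr_deriv (by ring)
  have hanti := antitoneOn_of_deriv_nonpos (convex_Icc (0:ℝ) 1)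
    (fun t _ => (hd t).continuousAt.continuousWithinAt)
    (fun t _ => (hd t).differentiableAt.differentiableWithinAt)
    (by
      intro t ht
      rw [interior_Icc] at ht
      rw [(hd t).deriv]
      have h1 : inner ℝ (f' (u + t • d) - f' u) d ≤ ‖f' (u + t • d) - f' u‖ * ‖d‖ :=
        real_inner_le_norm _ _
      have h2 := hsmooth (u + t • d) u
      rw [add_sub_cancel_left, norm_smul, Real.norm_eq_abs, abs_of_pos ht.1] at h2
      have h3 := mul_le_mul_of_nonneg_right h2 (norm_nonneg d)
      rw [inner_sub_left] at h1
      linarith)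
  have := hanti (Set.left_mem_Icc.2 zero_le_one) (Set.right_mem_Icc.2 zero_le_one) zero_le_one
  simp at this
  linarith

theorem gd_convex (f : E → ℝ) (f' : E → E)
    (hgrad : ∀ u, HasGradientAt f (f' u) u) (hconv : ConvexOn ℝ Set.univ f) (u d : E) :
    f u + inner ℝ (f' u) d ≤ f (u + d) := by
  have hc : ConvexOn ℝ Set.univ (fun t : ℝ => f (u + t • d)) := by
    refine ⟨convex_univ, ?_⟩
    intro s _ t _ a b ha hb hab
    have h := hconv.2 (Set.mem_univ (u + s • d)) (Set.mem_univ (u + t • d)) ha hb hab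
    have e : a • (u + s • d) + b • (u + t • d) = u + (a • s + b • t) • d := by
      have : u = (a + b) • u := by rw [hab, one_smul]
      conv_rhs => rw [this]
      simp only [smul_eq_mul]
      module
    rw [e] at h
    exact h
  have h1 := gd_line_deriv f f' hgrad u d 0
  have := hc.le_slope_of_hasDerivAt (Set.mem_univ 0) (Set.mem_univ 1) zero_lt_one h1
  simp [slope_def_field] at this
  linarith

theorem gd_cocoer (f : E → ℝ) (f' : E → E)
    (hgrad : ∀ u, HasGradientAt f (f' u) u) (hconv : ConvexOn ℝ Set.univ f)
    (L : ℝ) (hL : 0 < L)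
    (hsmooth : ∀ u v, ‖f' u - f' v‖ ≤ L * ‖u - v‖) (u v : E) :
    f u + inner ℝ (f' u) (v - u) + 1 / (2 * L) * ‖f' v - f' u‖ ^ 2 ≤ f v := by
  have h1 := gd_descent f f' hgrad L hsmooth v (-((1 / L) • (f' v - f' u)))
  have h2 := gd_convex f f' hgrad hconv u (v - u + -((1 / L) • (f' v - f' u)))
  have e : u + (v - u + -((1 / L) • (f' v - f' u))) = v + -((1 / L) • (f' v - f' u)) := by abel
  rw [e, inner_add_right] at h2
  rw [norm_neg, norm_smul, mul_pow, Real.norm_eq_abs, sq_abs] at h1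
  have e3 : inner ℝ (f' v) (f' v - f' u) - inner ℝ (f' u) (f' v - f' u) = ‖f' v - f' u‖ ^ 2 := by
    rw [← inner_sub_left, real_inner_self_eq_norm_sq]
  simp only [inner_neg_right, inner_smul_right] at h1 h2
  have e4 : L / 2 * ((1 / L) ^ 2 * ‖f' v - f' u‖ ^ 2) = 1 / (2 * L) * ‖f' v - f' u‖ ^ 2 := by
    field_simp
  have e5 : 1 / L * inner ℝ (f' v) (f' v - f' u) - 1 / L * inner ℝ (f' u) (f' v - f' u)
      = 2 * (1 / (2 * L) * ‖f' v - f' u‖ ^ 2) := by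
    rw [← mul_sub, e3]; field_simp
  linarith

theorem gd_step (f : E → ℝ) (f' : E → E)
    (hgrad : ∀ u, HasGradientAt f (f' u) u) (hconv : ConvexOn ℝ Set.univ f)
    (L : ℝ) (hL : 0 < L)
    (hsmooth : ∀ u v, ‖f' u - f' v‖ ≤ L * ‖u - v‖) (u : E) :
    2 * L * f (u - (1 / L) • f' u) + ‖f' u‖ ^ 2 ≤ 2 * L * f u ∧
    ‖f' (u - (1 / L) • f' u)‖ ^ 2 ≤ ‖f' u‖ ^ 2 := by
  constructor
  · have h1 := gd_descent f f' hgrad L hsmooth u (-((1 / L) • f' u))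
    rw [norm_neg, norm_smul, mul_pow, Real.norm_eq_abs, sq_abs, inner_neg_right,
      inner_smul_right, real_inner_self_eq_norm_sq, ← sub_eq_add_neg] at h1
    have h2 := mul_le_mul_of_nonneg_left h1 (by positivity : 0 ≤ 2 * L)
    have e : 2 * L * (f u + -(1 / L * ‖f' u‖ ^ 2) + L / 2 * ((1 / L) ^ 2 * ‖f' u‖ ^ 2))
        = 2 * L * f u - ‖f' u‖ ^ 2 := by
      field_simp; ring
    linarith
  · set v := u - (1 / L) • f' u with hv
    have h1 := gd_cocoer f f' hgrad hconv L hL hsmooth u v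
    have h2 := gd_cocoer f f' hgrad hconv L hL hsmooth v u
    have e1 : v - u = -((1 / L) • f' u) := by rw [hv]; abel
    have e2 : u - v = (1 / L) • f' u := by rw [hv]; abel
    rw [e1, inner_neg_right, inner_smul_right, real_inner_self_eq_norm_sq] at h1
    rw [e2, inner_smul_right, norm_sub_rev] at h2
    have h3 : 1 / L * (inner ℝ (f' v) (f' u) + ‖f' v - f' u‖ ^ 2) ≤ 1 / L * ‖f' u‖ ^ 2 := by
      have : 1 / L * ‖f' v - f' u‖ ^ 2 = 2 * (1 / (2 * L) * ‖f' v - f' u‖ ^ 2) := by field_simp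
      linarith
    have h4 := le_of_mul_le_mul_left h3 (by positivity)
    have h5 := norm_sub_sq_real (f' v) (f' u)
    have h6 : 0 ≤ ‖f' v - f' u‖ ^ 2 := by positivity
    linarith

end helpers



/-- Final-gradient bound after `K` steps of Gradient Descent (building block for Lemma 1). -/
theorem gd_final_gradient_bound
    {E : Type*} [NormedAddCommGroup E] [InnerProductSpace ℝ E] [FiniteDimensional ℝ E]
    (f : E → ℝ) (f' : E → E)
    (hgrad : ∀ u, HasGradientAt f (f' u) u)
    (hconv : ConvexOn ℝ Set.univ f)
    (L : ℝ) (hL : 0 < L)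
    (hsmooth : ∀ u v, ‖f' u - f' v‖ ≤ L * ‖u - v‖)
    (xstar : E) (hmin : ∀ u, f xstar ≤ f u)
    (K : ℕ) (hK : 1 ≤ K)
    (x : ℕ → E)
    (hupd : ∀ j, K ≤ j → j < 2 * K → x (j + 1) = x j - (1 / L) • f' (x j)) :
    ‖f' (x (2 * K))‖ ^ 2 ≤ 2 * L * (f (x K) - f xstar) / ((K : ℝ) + 1) := by
  have key : ∀ n : ℕ, n ≤ K →
      2 * L * f (x (K + n)) + n * ‖f' (x (K + n))‖ ^ 2 ≤ 2 * L * f (x K) := by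
    intro n
    induction n with
    | zero => intro _; simp
    | succ n ih =>
      intro hn
      have h := ih (by omega)
      have hs := gd_step f f' hgrad hconv L hL hsmooth (x (K + n))
      rw [← hupd (K + n) (by omega) (by omega)] at hs
      have h2 := mul_le_mul_of_nonneg_left hs.2 (by positivity : (0:ℝ) ≤ (n:ℝ) + 1)
      rw [← add_assoc]
      push_cast
      linarith [hs.1]
  have h1 := key K le_rfl
  rw [← two_mul] at h1
  have h2 := (gd_step f f' hgrad hconv L hL hsmooth (x (2 * K))).1
  have h3 := mul_le_mul_of_nonneg_left (hmin (x (2 * K) - (1 / L) • f' (x (2 * K))))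
    (by positivity : 0 ≤ 2 * L)
  rw [le_div_iff₀ (by positivity)]
  linarith
end
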